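/- Let n ≥ 3. Then H(Res(f₀+f₁x+f₂x², g)) = n · (n−Aₙ−1)! / ((n−2Aₙ)! · Aₙ!). -/

import Mathlib

noncomputable section

open MvPolynomial

/-- The quadratic polynomial `p_n(z) = (n-2z+1)(n-2z+2) - z(n-z)`. -/
def pquad (n : ℕ) (z : ℝ) : ℝ :=
  ((n : ℝ) - 2 * z + 1) * ((n : ℝ) - 2 * z + 2) - z * ((n : ℝ) - z)

/-- The generic Sylvester matrix of a degree-`m` polynomial `f = f₀ + ⋯ + f_m xᵐ` and a
degree-`n` polynomial `g = g₀ + ⋯ + gₙ xⁿ`: its first `n` columns contain the shifted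
coefficients of `f` (the indeterminates `Sum.inl i`) and its last `m` columns contain the
shifted coefficients of `g` (the indeterminates `Sum.inr j`). -/
def sylvesterMatrix (m n : ℕ) :
    Matrix (Fin (m + n)) (Fin (m + n)) (MvPolynomial (Fin (m + 1) ⊕ Fin (n + 1)) ℤ) :=
  Matrix.of fun i j =>
    if (j : ℕ) < n then
      if h : (j : ℕ) ≤ (i : ℕ) ∧ (i : ℕ) - (j : ℕ) ≤ m then
        X (Sum.inl ⟨(i : ℕ) - (j : ℕ), Nat.lt_succ_of_le h.2⟩)
      else 0
    else
      if h : (j : ℕ) - n ≤ (i : ℕ) ∧ (i : ℕ) - ((j : ℕ) - n) ≤ n then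
        X (Sum.inr ⟨(i : ℕ) - ((j : ℕ) - n), Nat.lt_succ_of_le h.2⟩)
      else 0

/-- `genRes m n` is the Sylvester resultant `Res(f,g)` of the generic polynomials
`f` of degree `m` and `g` of degree `n`. -/
def genRes (m n : ℕ) : MvPolynomial (Fin (m + 1) ⊕ Fin (n + 1)) ℤ :=
  (sylvesterMatrix m n).det

/-- The height of an integer multivariate polynomial:
the maximum of the absolute values of its coefficients. -/
def height {σ : Type*} (P : MvPolynomial σ ℤ) : ℕ :=
  P.support.sup fun s => (P.coeff s).natAbs

/-- The coefficients of the Lucas polynomials: up to sign, `lucasCoeff d k` is the coefficient of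
`(α + β) ^ (d - 2 * k) * (α * β) ^ k` in `α ^ d + β ^ d`. -/
def lucasCoeff : ℕ → ℕ → ℕ
  | 0, 0 => 2
  | 0, _ + 1 => 0
  | 1, 0 => 1
  | 1, _ + 1 => 0
  | _ + 2, 0 => 1
  | d + 2, k + 1 => lucasCoeff (d + 1) (k + 1) + lucasCoeff d k

theorem lucasCoeff_zero_right {d : ℕ} (hd : d ≠ 0) : lucasCoeff d 0 = 1 := by
  match d, hd with
  | 1, _ => rfl
  | _ + 2, _ => rfl

theorem lucasCoeff_add_two (d k : ℕ) :
    lucasCoeff (d + 2) (k + 1) = lucasCoeff (d + 1) (k + 1) + lucasCoeff d k := rfl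

theorem lucasCoeff_eq_zero : ∀ {d k : ℕ}, d < 2 * k → lucasCoeff d k = 0
  | 0, 0, h => by omega
  | 1, 0, h => by omega
  | _ + 2, 0, h => by omega
  | 0, _ + 1, _ => rfl
  | 1, _ + 1, _ => rfl
  | d + 2, k + 1, h => by
    rw [lucasCoeff_add_two, lucasCoeff_eq_zero (by omega), lucasCoeff_eq_zero (by omega)]

theorem lucasCoeff_mul_factorial (k e : ℕ) (h : 0 < 2 * k + e) :
    lucasCoeff (2 * k + e) k * (e.factorial * k.factorial) =
      (2 * k + e) * (k + e - 1).factorial := by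
  induction k generalizing e with
  | zero =>
    obtain ⟨e, rfl⟩ : ∃ e', e = e' + 1 := ⟨e - 1, by omega⟩
    simp [lucasCoeff_zero_right, Nat.factorial_succ]
  | succ k ihk =>
    induction e with
    | zero =>
      rcases Nat.eq_zero_or_pos k with rfl | hk
      · rfl
      · obtain ⟨k, rfl⟩ : ∃ k', k = k' + 1 := ⟨k - 1, by omega⟩
        have h0 := ihk 0 (by omega)
        rw [show 2 * (k + 1 + 1) + 0 = 2 * (k + 1) + 2 by ring, lucasCoeff_add_two,
          lucasCoeff_eq_zero (by omega)]
        simp only [add_zero, Nat.add_sub_cancel, Nat.factorial_succ, Nat.factorial_zero] at h0 ⊢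
        have := Nat.factorial_pos k
        linear_combination (k + 2) * h0
    | succ e ihe =>
      have h0 := ihk (e + 1) (by omega)
      have h1 := ihe (by omega)
      rw [show 2 * (k + 1) + (e + 1) = (2 * k + (e + 1)) + 2 by ring, lucasCoeff_add_two]
      rw [show 2 * (k + 1) + e = 2 * k + (e + 1) + 1 by ring,
        show k + 1 + e - 1 = k + e by omega] at h1
      rw [show k + (e + 1) - 1 = k + e by omega] at h0
      rw [show k + 1 + (e + 1) - 1 = k + e + 1 by omega]
      simp only [Nat.factorial_succ] at h0 h1 ⊢
      linear_combination (k + 1) * h0 + (e + 1) * h1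

theorem lucasCoeff_le_succ_left {d : ℕ} (hd : d ≠ 0) (k : ℕ) :
    lucasCoeff d k ≤ lucasCoeff (d + 1) k := by
  obtain ⟨d, rfl⟩ : ∃ d', d = d' + 1 := ⟨d - 1, by omega⟩
  cases k with
  | zero => simp [lucasCoeff_zero_right]
  | succ k => rw [lucasCoeff_add_two]; omega

theorem lucasCoeff_le_of_le {d n : ℕ} (hd : d ≠ 0) (h : d ≤ n) (k : ℕ) :
    lucasCoeff d k ≤ lucasCoeff n k := by
  induction n, h using Nat.le_induction with
  | base => rfl
  | succ n hn ih => exact ih.trans (lucasCoeff_le_succ_left (by omega) k)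

theorem lucasCoeff_succ_mul {n k : ℕ} (h : 2 * (k + 1) ≤ n) :
    lucasCoeff n (k + 1) * ((k + 1) * (n - (k + 1))) =
      lucasCoeff n k * ((n - 2 * (k + 1) + 1) * (n - 2 * (k + 1) + 2)) := by
  obtain ⟨e, rfl⟩ := Nat.exists_eq_add_of_le h
  have h1 := lucasCoeff_mul_factorial (k + 1) e (by omega)
  have h0 := lucasCoeff_mul_factorial k (e + 2) (by omega)
  rw [show 2 * k + (e + 2) = 2 * (k + 1) + e by ring,
    show k + (e + 2) - 1 = k + e + 1 by omega] at h0
  rw [show k + 1 + e - 1 = k + e by omega] at h1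
  rw [show 2 * (k + 1) + e - (k + 1) = k + e + 1 by omega,
    show 2 * (k + 1) + e - 2 * (k + 1) = e by omega]
  simp only [Nat.factorial_succ] at h0 h1
  have hpos : 0 < e.factorial * k.factorial := by positivity
  refine Nat.eq_of_mul_eq_mul_right hpos ?_
  linear_combination (k + e + 1) * h1 - h0

theorem pquad_sub (n : ℕ) (x r : ℝ) :
    pquad n x - pquad n r = (r - x) * (5 * (n - (x + r)) + 6) := by
  unfold pquad; ring

theorem lucasCoeff_le_floor_root {n : ℕ} {r : ℝ} (hr : r ∈ Set.Icc 0 ((n : ℝ) / 2))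
    (hroot : pquad n r = 0) {A : ℕ} (hA : (A : ℤ) = ⌊r⌋) {k : ℕ} (hk : 2 * k ≤ n) :
    lucasCoeff n k ≤ lucasCoeff n A := by
  obtain ⟨hAr, hrA⟩ : (A : ℝ) ≤ r ∧ r < A + 1 := by
    have := Int.floor_eq_iff.1 hA.symm
    exact_mod_cast this
  have hpquad : ∀ k : ℕ, 2 * (k + 1) ≤ n → pquad n ((k : ℝ) + 1) =
      (((n - 2 * (k + 1) + 1) * (n - 2 * (k + 1) + 2) : ℕ) : ℝ)
        - (((k + 1) * (n - (k + 1)) : ℕ) : ℝ) := by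
    intro k hk
    push_cast [Nat.cast_sub hk, Nat.cast_sub (show k + 1 ≤ n by omega)]
    unfold pquad; ring
  have hhalf : ∀ k : ℕ, 2 * (k + 1) ≤ n → (k : ℝ) + 1 ≤ n / 2 := by
    intro k hk
    have : (2 * (k + 1) : ℝ) ≤ n := by exact_mod_cast hk
    linarith
  have hA2 : 2 * A ≤ n := by
    have : (2 * A : ℝ) ≤ n := by linarith [hr.2]
    exact_mod_cast this
  have hup : ∀ k : ℕ, k < A → lucasCoeff n k ≤ lucasCoeff n (k + 1) := by
    intro k hkA
    have hkn : 2 * (k + 1) ≤ n := by omega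
    have hkr : (k : ℝ) + 1 ≤ r := le_trans (by exact_mod_cast hkA) hAr
    have hp : 0 ≤ pquad n ((k : ℝ) + 1) := by
      have := pquad_sub n (k + 1) r
      have := mul_nonneg (sub_nonneg.2 hkr)
        (show (0 : ℝ) ≤ 5 * (n - (k + 1 + r)) + 6 by linarith [hr.2, hhalf k hkn])
      linarith
    rw [hpquad k hkn, sub_nonneg, Nat.cast_le] at hp
    have hpos : 0 < (k + 1) * (n - (k + 1)) := Nat.mul_pos (by omega) (by omega)
    refine Nat.le_of_mul_le_mul_right ?_ hpos
    rw [lucasCoeff_succ_mul hkn]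
    exact Nat.mul_le_mul_left _ hp
  have hdown : ∀ k : ℕ, A ≤ k → 2 * (k + 1) ≤ n → lucasCoeff n (k + 1) ≤ lucasCoeff n k := by
    intro k hkA hkn
    have hkr : r ≤ (k : ℝ) + 1 := hrA.le.trans (by exact_mod_cast Nat.succ_le_succ hkA)
    have hp : pquad n ((k : ℝ) + 1) ≤ 0 := by
      have := pquad_sub n (k + 1) r
      have := mul_nonneg (sub_nonneg.2 hkr)
        (show (0 : ℝ) ≤ 5 * (n - (k + 1 + r)) + 6 by linarith [hr.2, hhalf k hkn])
      linarith
    rw [hpquad k hkn, sub_nonpos, Nat.cast_le] at hp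
    have hpos : 0 < (k + 1) * (n - (k + 1)) := Nat.mul_pos (by omega) (by omega)
    refine Nat.le_of_mul_le_mul_right ?_ hpos
    rw [lucasCoeff_succ_mul hkn]
    exact Nat.mul_le_mul_left _ hp
  rcases le_total k A with hkA | hkA
  · refine Nat.decreasingInduction' (P := fun j => lucasCoeff n j ≤ lucasCoeff n A)
      (fun j hj _ ih => (hup j hj).trans ih) hkA le_rfl
  · induction k, hkA using Nat.le_induction with
    | base => rfl
    | succ k hkA ih => exact (hdown k hkA hk).trans (ih (by omega))

theorem sum_lucasCoeff_eq_pow_add_pow {R : Type*} [CommRing R] (α β : R) :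
    ∀ {d N : ℕ}, d < 2 * N →
      ∑ k ∈ Finset.range N,
        (lucasCoeff d k : R) * ((α + β) ^ (d - 2 * k) * (-(α * β)) ^ k) = α ^ d + β ^ d
  | _, 0, h => by omega
  | 0, N + 1, _ => by
    rw [Finset.sum_range_succ', Finset.sum_eq_zero fun k _ => by simp [lucasCoeff]]
    norm_num [lucasCoeff]
  | 1, N + 1, _ => by
    rw [Finset.sum_range_succ', Finset.sum_eq_zero fun k _ => by simp [lucasCoeff]]
    simp [lucasCoeff]
  | d + 2, N + 1, h => by
    have h1 := sum_lucasCoeff_eq_pow_add_pow α β (d := d + 1) (N := N + 1) (by omega)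
    have h0 := sum_lucasCoeff_eq_pow_add_pow α β (d := d) (N := N) (by omega)
    rw [show α ^ (d + 2) + β ^ (d + 2) =
      (α + β) * (α ^ (d + 1) + β ^ (d + 1)) + -(α * β) * (α ^ d + β ^ d) by ring, ← h1, ← h0,
      Finset.sum_range_succ', Finset.sum_range_succ' _ N, mul_add, Finset.mul_sum, Finset.mul_sum,
      add_right_comm, ← Finset.sum_add_distrib]
    congr 1
    · refine Finset.sum_congr rfl fun k _ => ?_
      rw [lucasCoeff_add_two, show d + 2 - 2 * (k + 1) = d - 2 * k by omega]
      rcases lt_or_ge (d + 1) (2 * (k + 1)) with hlt | hge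
      · rw [lucasCoeff_eq_zero hlt]
        push_cast; ring
      · rw [show d - 2 * k = d + 1 - 2 * (k + 1) + 1 by omega]
        push_cast; ring
    · simp [lucasCoeff_zero_right]
      ring

theorem natAbs_coeff_le_height {σ : Type*} (P : MvPolynomial σ ℤ) (s : σ →₀ ℕ) :
    (P.coeff s).natAbs ≤ height P := by
  by_cases hs : s ∈ P.support
  · exact Finset.le_sup (f := fun s => (P.coeff s).natAbs) hs
  · simp [MvPolynomial.notMem_support_iff.1 hs]

theorem height_sum_monomial {σ ι : Type*} (T : Finset ι) (e : ι → σ →₀ ℕ) (c : ι → ℤ)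
    (he : Set.InjOn e T) :
    height (∑ t ∈ T, monomial (e t) (c t)) = T.sup fun t => (c t).natAbs := by
  classical
  have hcoeff : ∀ t ∈ T, (∑ t ∈ T, monomial (e t) (c t)).coeff (e t) = c t := by
    intro t ht
    simp only [MvPolynomial.coeff_sum, MvPolynomial.coeff_monomial]
    rw [Finset.sum_eq_single_of_mem t ht fun u hu hut => if_neg fun h => hut (he hu ht h),
      if_pos rfl]
  refine le_antisymm (Finset.sup_le fun s hs => ?_) (Finset.sup_le fun t ht => ?_)
  · obtain ⟨t, ht, hts⟩ := Finset.exists_ne_zero_of_sum_ne_zero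
      (by simpa only [MvPolynomial.mem_support_iff, MvPolynomial.coeff_sum] using hs)
    rw [MvPolynomial.coeff_monomial] at hts
    obtain rfl : e t = s := by
      by_contra h
      exact hts (if_neg h)
    rw [hcoeff t ht]
    exact Finset.le_sup (f := fun t => (c t).natAbs) ht
  · rw [← hcoeff t ht]
    exact natAbs_coeff_le_height _ _

/-- The signed coefficients of the resultant of a quadratic polynomial with another polynomial. -/
def quadResCoeff (d k : ℕ) : ℤ :=
  if d = 0 then 1 else (-1) ^ (d + k) * lucasCoeff d k

/-- The index set of the monomials of the resultant of a quadratic polynomial with a polynomial of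
degree `n`. -/
def quadResIndex (n : ℕ) : Finset ((Fin (n + 1) × Fin (n + 1)) × ℕ) :=
  (Finset.univ ×ˢ Finset.range (n + 1)).filter
    fun t => t.1.1 ≤ t.1.2 ∧ 2 * t.2 ≤ (t.1.2 : ℕ) - t.1.1

theorem sum_symmetrize {ι M : Type*} [Fintype ι] [LinearOrder ι] [AddCommMonoid M]
    (h : ι → ι → M) :
    ∑ i, ∑ j, h i j =
      ∑ p : ι × ι, if p.1 = p.2 then h p.1 p.1
        else if p.1 < p.2 then h p.1 p.2 + h p.2 p.1 else 0 := by
  have hsplit : ∀ i j, (if i = j then h i i else if i < j then h i j + h j i else 0) =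
      ((if i = j then h i j else 0) + if i < j then h i j else 0) +
        if i < j then h j i else 0 := by
    intro i j
    split_ifs with h1 h2 <;> simp_all
  rw [Fintype.sum_prod_type]
  simp only [hsplit, Finset.sum_add_distrib]
  rw [Finset.sum_comm (f := fun i j => if i < j then h j i else 0)]
  simp only [← Finset.sum_add_distrib]
  refine Finset.sum_congr rfl fun i _ => Finset.sum_congr rfl fun j _ => ?_
  rcases lt_trichotomy i j with hij | rfl | hij
  · simp [hij, hij.ne, hij.not_gt]
  · simp
  · simp [hij, hij.ne', hij.not_gt]

theorem sum_mul_sum_eq_sum_quadResIndex {R : Type*} [CommRing R] (n : ℕ) (a α β : R)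
    (g : Fin (n + 1) → R) :
    a ^ n * ((∑ i, g i * α ^ (i : ℕ)) * ∑ j, g j * β ^ (j : ℕ)) =
      ∑ t ∈ quadResIndex n, (quadResCoeff (t.1.2 - t.1.1) t.2 : R) *
        ((a * (α * β)) ^ (t.1.1 + t.2 : ℕ) * (-a * (α + β)) ^ (t.1.2 - t.1.1 - 2 * t.2 : ℕ) *
          a ^ (n - t.1.2 + t.2 : ℕ) * (g t.1.1 * g t.1.2)) := by
  rw [quadResIndex, Finset.sum_filter, Finset.sum_product, Finset.sum_mul_sum, sum_symmetrize,
    Finset.mul_sum]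
  refine Finset.sum_congr rfl fun ⟨i, j⟩ _ => ?_
  have hj : (j : ℕ) ≤ n := Nat.lt_succ_iff.1 j.2
  dsimp only
  rcases lt_trichotomy i j with hij | rfl | hij
  · obtain ⟨d, hd⟩ := Nat.exists_eq_add_of_lt (Fin.lt_def.1 hij)
    obtain ⟨m, hm⟩ := Nat.exists_eq_add_of_le hj
    have hji : (j : ℕ) - i = d + 1 := by omega
    have hnj : n - (j : ℕ) = m := by omega
    have key : g i * α ^ (i : ℕ) * (g j * β ^ (j : ℕ)) + g j * α ^ (j : ℕ) * (g i * β ^ (i : ℕ))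
        = g i * g j * (α * β) ^ (i : ℕ) * (α ^ (d + 1) + β ^ (d + 1)) := by
      rw [hd]; ring
    rw [if_neg hij.ne, if_pos hij, key,
      ← sum_lucasCoeff_eq_pow_add_pow α β (N := n + 1) (by omega), Finset.mul_sum, Finset.mul_sum]
    refine Finset.sum_congr rfl fun k _ => ?_
    rw [hji, hnj]
    split_ifs with h
    · obtain ⟨e, he⟩ := Nat.exists_eq_add_of_le h.2
      rw [quadResCoeff, if_neg (by omega), show d + 1 - 2 * k = e by omega,
        show a ^ n = a ^ (m + i + 2 * k + e) by congr 1; omega, he]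
      have hsq : ((-1 : R) ^ k) * (-1) ^ k = 1 := by rw [← mul_pow]; simp
      have hsq' : ((-1 : R) ^ e) * (-1) ^ e = 1 := by rw [← mul_pow]; simp
      rw [neg_pow (α * β), neg_mul, neg_pow (a * _), mul_pow a (α + β)]
      push_cast
      have hsign : (-1 : R) ^ (2 * k + e + k) * (-1) ^ e = (-1) ^ k := by
        linear_combination ((-1 : R) ^ k * (-1) ^ k * (-1) ^ k) * hsq' + (-1) ^ k * hsq
      linear_combination (-(lucasCoeff (2 * k + e) k * g i * g j * a ^ (m + i + 2 * k + e) *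
        (α * β) ^ (i + k : ℕ) * (α + β) ^ e : R)) * hsign
    · rw [lucasCoeff_eq_zero (by
        by_contra hlt
        exact h ⟨hij.le, by omega⟩)]
      simp
  · obtain ⟨m, hm⟩ := Nat.exists_eq_add_of_le hj
    rw [if_pos rfl, Finset.sum_eq_single_of_mem 0 (by simp)]
    · rw [show n - (i : ℕ) = m by omega, show a ^ n = a ^ (i + m : ℕ) by rw [← hm]]
      simp [quadResCoeff]
      ring
    · intro k _ hk
      rw [if_neg]
      simp [hk]
  · rw [if_neg hij.ne', if_neg hij.not_gt, mul_zero, Finset.sum_eq_zero]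
    intro k _
    rw [if_neg fun h => h.1.not_gt hij]

theorem genRes_eq_resultant (m n : ℕ) :
    genRes m n = Polynomial.resultant
      (∑ i : Fin (m + 1), Polynomial.monomial (i : ℕ)
        (X (Sum.inl i) : MvPolynomial (Fin (m + 1) ⊕ Fin (n + 1)) ℤ))
      (∑ j : Fin (n + 1), Polynomial.monomial (j : ℕ) (X (Sum.inr j))) m n *
      (-1) ^ (m * n) := by
  have hcoeff : ∀ (p : ℕ) (u : Fin (p + 1) → MvPolynomial (Fin (m + 1) ⊕ Fin (n + 1)) ℤ) (k : ℕ),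
      (∑ i : Fin (p + 1), Polynomial.monomial (i : ℕ) (u i)).coeff k = if h : k < p + 1 then u ⟨k, h⟩ else 0 := by
    intro p u k
    simp only [Polynomial.finsetSum_coeff, Polynomial.coeff_monomial]
    split_ifs with h
    · rw [Finset.sum_eq_single_of_mem ⟨k, h⟩ (Finset.mem_univ _)]
      · simp
      · intro i _ hi
        rw [if_neg fun h' => hi (Fin.ext h')]
    · exact Finset.sum_eq_zero fun i _ => if_neg (by omega)
  rw [Polynomial.resultant_comm, mul_comm _ ((-1) ^ (m * n)), ← mul_assoc, ← mul_pow,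
    neg_one_mul, neg_neg, one_pow, one_mul, Polynomial.resultant, genRes,
    ← Matrix.det_reindex_self (finCongr (add_comm m n))]
  congr 1
  ext1 i j
  simp only [sylvesterMatrix, Matrix.of_apply, Matrix.reindex_apply, Matrix.submatrix_apply,
    finCongr_symm, Polynomial.sylvester, hcoeff, Set.mem_Icc, finCongr_apply,
    Fin.val_cast]
  induction j using Fin.addCases with
  | left j =>
    have hj := j.2
    simp only [Fin.val_castAdd, Fin.addCases_left, hj, if_true]
    split_ifs <;> first | rfl | omega
  | right j =>
    simp only [Fin.val_natAdd, Fin.addCases_right, Nat.add_sub_cancel_left]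
    rw [if_neg (by omega)]
    split_ifs <;> first | rfl | omega

theorem resultant_quadratic {K : Type*} [Field K] (a α β : K) {G : Polynomial K} {n : ℕ} (hG : G.natDegree ≤ n) :
    Polynomial.resultant
      (Polynomial.C a * ((Polynomial.X - Polynomial.C α) * (Polynomial.X - Polynomial.C β)))
      G 2 n = a ^ n * (G.eval α * G.eval β) := by
  have hdeg := Polynomial.natDegree_X_sub_C α
  have hdeg' := Polynomial.natDegree_X_sub_C β
  have h := Polynomial.resultant_mul_left (Polynomial.X - Polynomial.C α)
    (Polynomial.X - Polynomial.C β) G n hG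
  rw [hdeg, hdeg', Polynomial.resultant_X_sub_C_left _ _ _ hG,
    Polynomial.resultant_X_sub_C_left _ _ _ hG] at h
  rw [Polynomial.resultant_C_mul_left, h]

theorem exists_quadratic_eq_mul {K : Type*} [Field K] [IsAlgClosed K] {a : K} (ha : a ≠ 0)
    (b c : K) : ∃ α β, b = -a * (α + β) ∧ c = a * (α * β) := by
  obtain ⟨α, hα⟩ := IsAlgClosed.exists_root
    (Polynomial.C a * Polynomial.X ^ 2 + Polynomial.C b * Polynomial.X + Polynomial.C c)
    (by rw [Polynomial.degree_quadratic ha]; decide)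
  simp only [Polynomial.IsRoot, Polynomial.eval_add, Polynomial.eval_mul, Polynomial.eval_C,
    Polynomial.eval_pow, Polynomial.eval_X] at hα
  refine ⟨α, -b / a - α, by field_simp; ring, ?_⟩
  field_simp
  linear_combination hα

/-- The exponent vectors of the monomials of the resultant of a quadratic polynomial with a
polynomial of degree `n`. -/
def quadResExponent (n : ℕ) (t : (Fin (n + 1) × Fin (n + 1)) × ℕ) :
    Fin (2 + 1) ⊕ Fin (n + 1) →₀ ℕ :=
  Finsupp.single (Sum.inl 0) (t.1.1 + t.2) + Finsupp.single (Sum.inl 1) (t.1.2 - t.1.1 - 2 * t.2) +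
    Finsupp.single (Sum.inl 2) (n - t.1.2 + t.2) +
    (Finsupp.single (Sum.inr t.1.1) 1 + Finsupp.single (Sum.inr t.1.2) 1)

theorem quadResExponent_injOn (n : ℕ) : Set.InjOn (quadResExponent n) (quadResIndex n) := by
  rintro ⟨⟨i, j⟩, k⟩ h ⟨⟨i', j'⟩, k'⟩ h' heq
  simp only [quadResIndex, Finset.coe_filter, Set.mem_ofPred_eq] at h h'
  have hone := DFunLike.congr_fun heq (Sum.inl 1)
  have hpair : Finsupp.single i 1 + Finsupp.single j 1 =
      (Finsupp.single i' 1 + Finsupp.single j' 1 : Fin (n + 1) →₀ ℕ) := by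
    ext l
    have := DFunLike.congr_fun heq (Sum.inr l)
    simpa [quadResExponent, Finsupp.single_apply] using this
  rw [Finsupp.single_add_single_eq_single_add_single one_ne_zero one_ne_zero] at hpair
  obtain ⟨rfl, rfl⟩ : i = i' ∧ j = j' := by
    rcases hpair with h1 | ⟨-, rfl, rfl⟩ | ⟨h2, -⟩
    · exact h1
    · exact ⟨le_antisymm h.2.1 h'.2.1, le_antisymm h'.2.1 h.2.1⟩
    · omega
  simp [quadResExponent] at hone
  obtain rfl : k = k' := by omega
  rfl

universe u in
theorem exists_injective_isAlgClosed {R : Type u} [CommRing R] [IsDomain R] :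
    ∃ (K : Type u) (_ : Field K) (_ : IsAlgClosed K) (φ : R →+* K), Function.Injective φ :=
  ⟨AlgebraicClosure (FractionRing R), inferInstance, inferInstance,
    (algebraMap (FractionRing R) _).comp (algebraMap R (FractionRing R)),
    (algebraMap (FractionRing R) _).injective.comp (IsFractionRing.injective R _)⟩

theorem monomial_quadResExponent (n : ℕ) (t : (Fin (n + 1) × Fin (n + 1)) × ℕ) (c : ℤ) :
    monomial (quadResExponent n t) c = (c : MvPolynomial (Fin (2 + 1) ⊕ Fin (n + 1)) ℤ) *
      (X (Sum.inl 0) ^ (t.1.1 + t.2 : ℕ) * X (Sum.inl 1) ^ (t.1.2 - t.1.1 - 2 * t.2 : ℕ) *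
        X (Sum.inl 2) ^ (n - t.1.2 + t.2 : ℕ) * (X (Sum.inr t.1.1) * X (Sum.inr t.1.2))) := by
  have hX : ∀ s, (X s : MvPolynomial (Fin (2 + 1) ⊕ Fin (n + 1)) ℤ) = X s ^ 1 :=
    fun s => (pow_one _).symm
  rw [hX (Sum.inr t.1.1), hX (Sum.inr t.1.2), ← map_intCast (C : ℤ →+* MvPolynomial (Fin (2 + 1) ⊕ Fin (n + 1)) ℤ)]
  simp only [X_pow_eq_monomial, monomial_mul, C_mul_monomial, quadResExponent]
  simp

theorem genRes_two (n : ℕ) :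
    genRes 2 n = ∑ t ∈ quadResIndex n,
      monomial (quadResExponent n t) (quadResCoeff (t.1.2 - t.1.1) t.2) := by
  obtain ⟨K, _, _, φ, hφ⟩ := exists_injective_isAlgClosed
    (R := MvPolynomial (Fin (2 + 1) ⊕ Fin (n + 1)) ℤ)
  have ha : φ (X (Sum.inl 2)) ≠ 0 := (map_ne_zero_iff φ hφ).2 (MvPolynomial.X_ne_zero _)
  obtain ⟨α, β, hb, hc⟩ := exists_quadratic_eq_mul ha (φ (X (Sum.inl 1))) (φ (X (Sum.inl 0)))
  have hF : Polynomial.map φ (∑ i : Fin (2 + 1), Polynomial.monomial (i : ℕ) (X (Sum.inl i))) =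
      Polynomial.C (φ (X (Sum.inl 2))) *
        ((Polynomial.X - Polynomial.C α) * (Polynomial.X - Polynomial.C β)) := by
    rw [Fin.sum_univ_three, Polynomial.map_add, Polynomial.map_add, Polynomial.map_monomial,
      Polynomial.map_monomial, Polynomial.map_monomial, hb, hc]
    simp only [← Polynomial.C_mul_X_pow_eq_monomial, Polynomial.C_mul, Polynomial.C_add,
      Polynomial.C_neg, Fin.val_zero, Fin.val_one, Fin.val_two]
    ring
  apply hφ
  rw [genRes_eq_resultant, map_mul, ← Polynomial.resultant_map_map, hF,
    resultant_quadratic, (even_two_mul n).neg_one_pow, map_one, mul_one]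
  · simp only [Polynomial.map_sum, Polynomial.map_monomial, Polynomial.eval_finsetSum,
      Polynomial.eval_monomial]
    rw [sum_mul_sum_eq_sum_quadResIndex, map_sum, ← hb, ← hc]
    refine Finset.sum_congr rfl fun t _ => ?_
    rw [monomial_quadResExponent]
    simp only [map_mul, map_pow, map_intCast]
  · refine (Polynomial.natDegree_map_le).trans
      (Polynomial.natDegree_sum_le_of_forall_le _ _ fun j _ => ?_)
    exact (Polynomial.natDegree_monomial_le _).trans (Nat.lt_succ_iff.1 j.2)

/-- For `n ≥ 3`, `H(Res(f₀+f₁x+f₂x², g)) = n ⬝ (n-Aₙ-1)! / ((n-2Aₙ)! ⬝ Aₙ!)`, where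
`Aₙ = ⌊rₙ⌋` and `rₙ` is the (unique) root of `p_n` in `[0, n/2]`. -/
theorem height_quadratic (n : ℕ) (hn : 3 ≤ n) (r : ℝ)
    (hr : r ∈ Set.Icc 0 ((n : ℝ) / 2)) (hroot : pquad n r = 0)
    (A : ℕ) (hA : (A : ℤ) = ⌊r⌋) :
    (height (genRes 2 n) : ℝ) =
      n * (Nat.factorial (n - A - 1)) / (Nat.factorial (n - 2 * A) * Nat.factorial A) := by
  obtain ⟨hAr, -⟩ : (A : ℝ) ≤ r ∧ r < A + 1 := by
    have := Int.floor_eq_iff.1 hA.symm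
    exact_mod_cast this
  have hA2 : 2 * A ≤ n := by
    have : (2 * A : ℝ) ≤ n := by linarith [hr.2]
    exact_mod_cast this
  have hheight : height (genRes 2 n) = lucasCoeff n A := by
    rw [genRes_two, height_sum_monomial _ _ _ (quadResExponent_injOn n)]
    refine le_antisymm (Finset.sup_le fun ⟨⟨i, j⟩, k⟩ ht => ?_) ?_
    · simp only [quadResIndex, Finset.mem_filter] at ht
      dsimp only
      rw [quadResCoeff]
      split_ifs with hd
      · exact (lucasCoeff_zero_right (d := n) (by omega)).ge.trans
          (lucasCoeff_le_floor_root hr hroot hA (by omega))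
      · rw [Int.natAbs_mul, Int.natAbs_pow, Int.natAbs_neg, Int.natAbs_one, one_pow, one_mul,
          Int.natAbs_natCast]
        exact (lucasCoeff_le_of_le hd (by omega) k).trans
          (lucasCoeff_le_floor_root hr hroot hA (by omega))
    · have hmem : (((0 : Fin (n + 1)), Fin.last n), A) ∈ quadResIndex n := by
        simp only [quadResIndex, Finset.mem_filter, Finset.mem_product, Finset.mem_univ,
          Finset.mem_range, Fin.val_last, Fin.val_zero]
        exact ⟨⟨trivial, by omega⟩, Fin.zero_le _, by omega⟩
      refine le_trans (le_of_eq ?_) (Finset.le_sup hmem)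
      simp [quadResCoeff, show n ≠ 0 by omega, Int.natAbs_mul]
  have hfac := lucasCoeff_mul_factorial A (n - 2 * A) (by omega)
  rw [show 2 * A + (n - 2 * A) = n by omega,
    show A + (n - 2 * A) - 1 = n - A - 1 by omega] at hfac
  rw [hheight, eq_div_iff (by positivity)]
  exact_mod_cast hfac
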